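/- Let (X, π) be an n-partite weighted simplicial complex of rank n, let 0 ≤ ℓ ≤ n, and let H be a k-regular labelled graph on the ℓ-element subsets of [n]. Then Gap(Papx) ≥ Gap(Udw_{ℓ↔n})·Gap*(H) and Gap(Paqx) ≥ Gap(Duw_{n↔ℓ})·Gap*(H²), where Papx = UpDown_{ℓ↔n}(X, π, H) is the expanderized up-down walk, Paqx = DownUp_{n↔ℓ}(X, π, H) is the expanderized down-up walk, Udw_{ℓ↔n} and Duw_{n↔ℓ} are the usual up-down and down-up walks, Gap(P) = 1 − λ₂(P), and Gap*(G) = 1 − λ(G). -/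

import Mathlib

open scoped Classical
noncomputable section

namespace Expanderized

/-! ## Generic weighted linear algebra over finite types -/

section Generic

variable {α β γ : Type*}

/-- Inner product `⟨f,g⟩_μ = E_{x∼μ}[f(x)g(x)]` with respect to a weight `μ`. -/
def inner' [Fintype α] (μ : α → ℝ) (f g : α → ℝ) : ℝ := ∑ x, μ x * (f x * g x)

/-- Expectation with respect to `μ`. -/
def expect [Fintype α] (μ : α → ℝ) (f : α → ℝ) : ℝ := ∑ x, μ x * f x

/-- `μ` is a probability distribution. -/
def IsProbDist [Fintype α] (μ : α → ℝ) : Prop := (∀ x, 0 ≤ μ x) ∧ (∑ x, μ x) = 1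

/-- A row-stochastic kernel. -/
def IsRowStochastic [Fintype β] (P : α → β → ℝ) : Prop :=
  (∀ x y, 0 ≤ P x y) ∧ ∀ x, (∑ y, P x y) = 1

/-- Product of two kernels (matrix multiplication). -/
def matMul [Fintype β] (A : α → β → ℝ) (B : β → γ → ℝ) : α → γ → ℝ :=
  fun x z => ∑ y, A x y * B y z

/-- Right action of a kernel on a function (column vector). -/
def mApp [Fintype β] (A : α → β → ℝ) (f : β → ℝ) : α → ℝ :=
  fun x => ∑ y, A x y * f y

/-- Left action of a kernel on a row vector / measure. -/
def rowMul [Fintype α] (μ : α → ℝ) (A : α → β → ℝ) : β → ℝ :=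
  fun y => ∑ x, μ x * A x y

/-- The adjoint of the kernel `P` with respect to the measures `(μ₁, μ₂)`. -/
def adjointKer [Fintype α] [Fintype β] (μ₁ : α → ℝ) (μ₂ : β → ℝ) (P : α → β → ℝ) :
    β → α → ℝ :=
  fun y x => P x y * μ₁ x / μ₂ y

/-- Iterates of a square kernel. -/
def matIter [Fintype α] [DecidableEq α] (A : α → α → ℝ) : ℕ → (α → α → ℝ)
  | 0 => fun x y => if x = y then 1 else 0
  | (t + 1) => matMul (matIter A t) A

/-- The second-largest eigenvalue `λ₂` of a random walk matrix that is reversible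
with respect to `μ`, via its Rayleigh-quotient (Courant–Fischer) characterization. -/
def lambda2 [Fintype α] (μ : α → ℝ) (A : α → α → ℝ) : ℝ :=
  sSup {r | ∃ f : α → ℝ, inner' μ f f = 1 ∧ inner' μ f (fun _ => 1) = 0 ∧
      r = inner' μ f (mApp A f)}

/-- The spectral gap `1 - λ₂`. -/
def specGap [Fintype α] (μ : α → ℝ) (A : α → α → ℝ) : ℝ := 1 - lambda2 μ A

/-- The two-sided expansion `λ(A) = max(λ₂(A), |λ_min(A)|)` of a random walk matrix
reversible with respect to `μ`, via its Rayleigh-quotient characterization. -/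
def twoSided [Fintype α] (μ : α → ℝ) (A : α → α → ℝ) : ℝ :=
  sSup {r | ∃ f : α → ℝ, inner' μ f f = 1 ∧ inner' μ f (fun _ => 1) = 0 ∧
      r = |inner' μ f (mApp A f)|}

/-- The operator norm `‖A‖_{op,μ}`. -/
def opNorm [Fintype α] (μ : α → ℝ) (A : α → α → ℝ) : ℝ :=
  sSup {r | ∃ f : α → ℝ, inner' μ f f = 1 ∧
      r = Real.sqrt (inner' μ (mApp A f) (mApp A f))}

/-- The `Φ`-entropy functional `Ent^Φ_μ(f) = E_μ[Φ(f)] - Φ(E_μ f)`. -/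
def phiEnt [Fintype α] (Φ : ℝ → ℝ) (μ : α → ℝ) (f : α → ℝ) : ℝ :=
  expect μ (fun x => Φ (f x)) - Φ (expect μ f)

/-- `t ↦ t log t`; note `Real.log 0 = 0`, so the convention `0 log 0 = 0` is built in. -/
def nlog (t : ℝ) : ℝ := t * Real.log t

/-- The usual entropy functional `Ent_μ`. -/
def ent [Fintype α] (μ : α → ℝ) (f : α → ℝ) : ℝ := phiEnt nlog μ f

/-- The `Φ`-entropy contraction constant of a kernel `P` with respect to measures
`(μ₁, μ₂)`: the largest `C ≥ 0` such that `Ent^Φ_{μ₁}(Pf) ≤ (1-C)·Ent^Φ_{μ₂}(f)`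
for all nonnegative `f`. -/
def CFphi [Fintype α] [Fintype β] (Φ : ℝ → ℝ) (μ₁ : α → ℝ) (μ₂ : β → ℝ)
    (P : α → β → ℝ) : ℝ :=
  sSup {C | 0 ≤ C ∧ ∀ f : β → ℝ, (∀ y, 0 ≤ f y) →
      phiEnt Φ μ₁ (mApp P f) ≤ (1 - C) * phiEnt Φ μ₂ f}

/-- The entropy contraction constant `EC(P)`. -/
def EC [Fintype α] [Fintype β] (μ₁ : α → ℝ) (μ₂ : β → ℝ) (P : α → β → ℝ) : ℝ :=
  CFphi nlog μ₁ μ₂ P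

/-- The log-Sobolev constant of a reversible kernel `P` with stationary measure `μ`:
the largest `C ≥ 0` with `C·Ent_μ(f²) ≤ ⟨f,(I-P)f⟩_μ` for all nonnegative `f`. -/
def LS [Fintype α] (μ : α → ℝ) (P : α → α → ℝ) : ℝ :=
  sSup {C | 0 ≤ C ∧ ∀ f : α → ℝ, (∀ x, 0 ≤ f x) →
      C * ent μ (fun x => f x ^ 2) ≤ inner' μ f (fun x => f x - mApp P f x)}

/-- The modified log-Sobolev constant of a reversible kernel `P` with stationary
measure `μ`: the largest `C ≥ 0` with `C·Ent_μ(f) ≤ ⟨f,(I-P) log f⟩_μ`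
for all strictly positive `f`. -/
def MLS [Fintype α] (μ : α → ℝ) (P : α → α → ℝ) : ℝ :=
  sSup {C | 0 ≤ C ∧ ∀ f : α → ℝ, (∀ x, 0 < f x) →
      C * ent μ f ≤
        inner' μ f (fun x => Real.log (f x) - mApp P (fun y => Real.log (f y)) x)}

/-- Total variation distance. -/
def tvDist [Fintype α] (μ ν : α → ℝ) : ℝ := (∑ x, |μ x - ν x|) / 2

/-- The `ε`-mixing time of a kernel `P` towards the target distribution `π`. -/
def mixingTime [Fintype α] [DecidableEq α] (P : α → α → ℝ) (π : α → ℝ) (ε : ℝ) : ℕ :=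
  sInf {t : ℕ | ∀ μ₀ : α → ℝ, IsProbDist μ₀ → tvDist (rowMul μ₀ (matIter P t)) π ≤ ε}

end Generic

/-! ## Weighted simplicial complexes -/

/-- A weighted (pure) simplicial complex of rank `n` on a finite vertex set `V`:
a downward-closed collection of faces, all maximal faces of cardinality `n`,
together with a fully supported probability distribution `pi` on the rank `n` faces
(extended by zero to all finsets). -/
structure WComplex (V : Type*) [Fintype V] [DecidableEq V] (n : ℕ) where
  faces : Finset (Finset V)
  pi : Finset V → ℝ
  faces_nonempty : faces.Nonempty
  down_closed : ∀ α ∈ faces, ∀ β ⊆ α, β ∈ faces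
  card_le : ∀ α ∈ faces, α.card ≤ n
  pure : ∀ α ∈ faces, ∃ ω ∈ faces, ω.card = n ∧ α ⊆ ω
  pi_pos : ∀ ω ∈ faces, ω.card = n → 0 < pi ω
  pi_zero_of_not_mem : ∀ ω : Finset V, ω ∉ faces → pi ω = 0
  pi_zero_of_card_ne : ∀ ω : Finset V, ω.card ≠ n → pi ω = 0
  pi_sum : (∑ ω : Finset V, pi ω) = 1

namespace WComplex

variable {V : Type*} [Fintype V] [DecidableEq V] {n : ℕ}

/-- `Pr_{ω∼π}[ω ⊇ α]` (unnormalized level mass of a face). -/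
def mass (K : WComplex V n) (α : Finset V) : ℝ :=
  ∑ ω : Finset V, if α ⊆ ω then K.pi ω else 0

/-- The induced distribution `π_j` on the `j`-th level `X^(j)`. -/
def level (K : WComplex V n) (j : ℕ) : Finset V → ℝ :=
  fun α => if α.card = j then ((n.choose j : ℝ))⁻¹ * K.mass α else 0

/-- The up-walk `Up_{ℓ→k}`. -/
def up (K : WComplex V n) (ℓ k : ℕ) : Finset V → Finset V → ℝ :=
  fun a b =>
    if a.card = ℓ ∧ b.card = k ∧ a ⊆ b then
      (((n - ℓ).choose (k - ℓ) : ℝ))⁻¹ * (K.mass b / K.mass a)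
    else 0

/-- The down-walk `Down_{k→ℓ}`. -/
def down (K : WComplex V n) (k ℓ : ℕ) : Finset V → Finset V → ℝ :=
  fun a b => if a.card = k ∧ b.card = ℓ ∧ b ⊆ a then ((k.choose ℓ : ℝ))⁻¹ else 0

/-- The down-up walk `Duw_{n↔ℓ} = Down_{n→ℓ}·Up_{ℓ→n}` on `X^(n)`. -/
def downUp (K : WComplex V n) (ℓ : ℕ) : Finset V → Finset V → ℝ :=
  matMul (K.down n ℓ) (K.up ℓ n)

/-- The up-down walk `Udw_{ℓ↔n} = Up_{ℓ→n}·Down_{n→ℓ}` on `X^(ℓ)`. -/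
def upDown (K : WComplex V n) (ℓ : ℕ) : Finset V → Finset V → ℝ :=
  matMul (K.up ℓ n) (K.down n ℓ)

/-- The top-level distribution `π^(ω̂)` of the link complex of the face `z`. -/
def linkPi (K : WComplex V n) (z : Finset V) : Finset V → ℝ :=
  fun α => if Disjoint α z then K.pi (z ∪ α) / K.mass z else 0

/-- Unnormalized level mass in the link of `z`. -/
def linkMass (K : WComplex V n) (z α : Finset V) : ℝ :=
  ∑ β : Finset V, if α ⊆ β then K.linkPi z β else 0

/-- The induced distribution `π^(ω̂)_j` on the `j`-th level of the link of `z`. -/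
def linkLevel (K : WComplex V n) (z : Finset V) (j : ℕ) : Finset V → ℝ :=
  fun α => if α.card = j then (((n - z.card).choose j : ℝ))⁻¹ * K.linkMass z α else 0

/-- The up-walk `Up^{ω̂}_{ℓ→k}` of the link complex of `z`. -/
def linkUp (K : WComplex V n) (z : Finset V) (ℓ k : ℕ) : Finset V → Finset V → ℝ :=
  fun a b =>
    if a.card = ℓ ∧ b.card = k ∧ a ⊆ b then
      ((((n - z.card) - ℓ).choose (k - ℓ) : ℝ))⁻¹ * (K.linkMass z b / K.linkMass z a)
    else 0

/-- The vertex marginal `π^(ω̂)_1` of the link of `z`, as a distribution on vertices. -/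
def linkVertex (K : WComplex V n) (z : Finset V) : V → ℝ :=
  fun x => K.linkLevel z 1 {x}

/-- The link random-walk matrix `M_ω̂` of a face `z` (with `|z| ≤ n-2`). -/
def linkMat (K : WComplex V n) (z : Finset V) : V → V → ℝ :=
  fun x y =>
    if x ≠ y then (K.mass (z ∪ {x, y}) / K.mass (z ∪ {x})) / ((n : ℝ) - z.card - 1)
    else 0

/-- The local `Φ`-entropy contraction constant `lc_Φ(ω̂)`: the smallest `c ≥ 0` with
`Ent^Φ_{π^(ω̂)_1}(Up^{ω̂}_{1→n'} g) ≤ c·Ent^Φ_{π^(ω̂)_{n'}}(g)` for all `g ≥ 0`,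
where `n' = n - |ω̂|`. -/
def lcPhi (K : WComplex V n) (Φ : ℝ → ℝ) (z : Finset V) : ℝ :=
  sInf {c | 0 ≤ c ∧ ∀ g : Finset V → ℝ, (∀ x, 0 ≤ g x) →
      phiEnt Φ (K.linkLevel z 1) (mApp (K.linkUp z 1 (n - z.card)) g)
        ≤ c * phiEnt Φ (K.linkLevel z (n - z.card)) g}

/-- The local entropy contraction constant `lec(ω̂)` (the case `Φ(t) = t log t`). -/
def lec (K : WComplex V n) (z : Finset V) : ℝ := K.lcPhi nlog z

end WComplex

/-! ## Partite complexes, auxiliary expander graphs, and expanderized walks -/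

section Partite

variable {n : ℕ} {U : Type*} [Fintype U] [DecidableEq U]

/-- The type of a face of an `n`-partite complex: the set of sides it meets. -/
def typ (α : Finset (Fin n × U)) : Finset (Fin n) := α.image Prod.fst

/-- The restriction `ω_S` of a face to the sides in `S`. -/
def restrict (ω : Finset (Fin n × U)) (S : Finset (Fin n)) : Finset (Fin n × U) :=
  ω.filter fun v => v.1 ∈ S

/-- An `n`-partite complex: every facet contains exactly one vertex from each side. -/
def IsPartite (K : WComplex (Fin n × U) n) : Prop :=
  ∀ ω ∈ K.faces, ω.card = n → (typ ω).card = n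

/-- `H` is a `k`-regular graph all of whose edges join `ℓ`-element subsets of `[n]`. -/
def IsRegularOnSubsets (H : SimpleGraph (Finset (Fin n))) (ℓ k : ℕ) : Prop :=
  (∀ S T, H.Adj S T → S.card = ℓ ∧ T.card = ℓ) ∧
  (∀ S : Finset (Fin n), S.card = ℓ → (Finset.univ.filter fun T => H.Adj S T).card = k)

/-- The simple random walk matrix of a `k`-regular graph `H`. -/
def walkMat (H : SimpleGraph (Finset (Fin n))) (k : ℕ) :
    Finset (Fin n) → Finset (Fin n) → ℝ :=
  fun S T => if H.Adj S T then (k : ℝ)⁻¹ else 0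

/-- The uniform distribution on `ℓ`-element subsets of `[n]`. -/
def unifSubsets (n ℓ : ℕ) : Finset (Fin n) → ℝ :=
  fun S => if S.card = ℓ then ((n.choose ℓ : ℝ))⁻¹ else 0

/-- The two-sided expansion `λ(H)` of `H`. -/
def lamH (H : SimpleGraph (Finset (Fin n))) (ℓ k : ℕ) : ℝ :=
  twoSided (unifSubsets n ℓ) (walkMat H k)

/-- The two-sided expansion `λ(H²)` of the square of `H` (i.e. of the graph whose
random walk matrix is the square of that of `H`). -/
def lamHsq (H : SimpleGraph (Finset (Fin n))) (ℓ k : ℕ) : ℝ :=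
  twoSided (unifSubsets n ℓ) (matMul (walkMat H k) (walkMat H k))

/-- `Pr_{ω∼π}[ω_{typ a} = a ∧ ω_{typ b} = b]`. -/
def jointMass (K : WComplex (Fin n × U) n) (a b : Finset (Fin n × U)) : ℝ :=
  ∑ ω : Finset (Fin n × U),
    if restrict ω (typ a) = a ∧ restrict ω (typ b) = b then K.pi ω else 0

/-- The expanderized up-down walk with type-transition matrix `W`; taking
`W = walkMat H k` gives `UpDown(X, π, H)`, and taking `W = (walkMat H k)²`
gives `UpDown(X, π, H²)`.  Its `(ω̂, ω̃)` entry is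
`W(typ ω̂, typ ω̃) · Pr_{ω∼π}[ω_{typ ω̃} = ω̃ ∣ ω_{typ ω̂} = ω̂]`. -/
def expUpDown (K : WComplex (Fin n × U) n)
    (W : Finset (Fin n) → Finset (Fin n) → ℝ) :
    Finset (Fin n × U) → Finset (Fin n × U) → ℝ :=
  fun a b => W (typ a) (typ b) * (jointMass K a b / jointMass K a a)

/-- The expanderized down-walk `Qdo` from `X^(n) × binom([n],ℓ)` to `X^(ℓ)`. -/
def Qdown (K : WComplex (Fin n × U) n) (H : SimpleGraph (Finset (Fin n))) (k : ℕ) :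
    Finset (Fin n × U) × Finset (Fin n) → Finset (Fin n × U) → ℝ :=
  fun p b => if H.Adj p.2 (typ b) ∧ b ⊆ p.1 then (k : ℝ)⁻¹ else 0

/-- The expanderized up-walk `Qup` from `X^(ℓ)` to `X^(n) × binom([n],ℓ)`
(the adjoint of `Qdown` with respect to `(π_n ⊗ Unif, π_ℓ)`). -/
def Qup (K : WComplex (Fin n × U) n) (H : SimpleGraph (Finset (Fin n))) (k : ℕ) :
    Finset (Fin n × U) → Finset (Fin n × U) × Finset (Fin n) → ℝ :=
  fun b p =>
    (if H.Adj p.2 (typ b) then (k : ℝ)⁻¹ else 0) *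
      ((if b ⊆ p.1 then K.pi p.1 else 0) / K.mass b)

/-- The expanderized down-up walk `Paqx = Qdo·Qup` on `X^(n) × binom([n],ℓ)`. -/
def expDownUp (K : WComplex (Fin n × U) n) (H : SimpleGraph (Finset (Fin n))) (k : ℕ) :
    Finset (Fin n × U) × Finset (Fin n) → Finset (Fin n × U) × Finset (Fin n) → ℝ :=
  matMul (Qdown K H k) (Qup K H k)

/-- The product distribution `π_n ⊗ Unif_{binom([n],ℓ)}`. -/
def prodDist (K : WComplex (Fin n × U) n) (ℓ : ℕ) :
    Finset (Fin n × U) × Finset (Fin n) → ℝ :=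
  fun p => K.pi p.1 * unifSubsets n ℓ p.2

end Partite

/-! ## List colorings -/

section Coloring

variable {n : ℕ} {Col : Type*} [Fintype Col] [DecidableEq Col]

/-- The degree of a vertex in a graph. -/
def degree' {W : Type*} [Fintype W] (G : SimpleGraph W) (v : W) : ℕ :=
  (Finset.univ.filter fun u => G.Adj v u).card

/-- A proper list coloring of `(G, L)`. -/
def IsProperColoring (G : SimpleGraph (Fin n)) (L : Fin n → Finset Col)
    (c : Fin n → Col) : Prop :=
  (∀ v, c v ∈ L v) ∧ ∀ u v, G.Adj u v → c u ≠ c v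

/-- The face `{(v, c v) : v}` associated to a coloring `c`. -/
def colorFace (c : Fin n → Col) : Finset (Fin n × Col) :=
  Finset.univ.image fun v => (v, c v)

/-- `Y` is the list-coloring complex of `(G, L)`: its faces are the subsets of proper
list colorings and its weight is the uniform distribution on proper list colorings. -/
def IsColoringComplex (G : SimpleGraph (Fin n)) (L : Fin n → Finset Col)
    (Y : WComplex (Fin n × Col) n) : Prop :=
  (∀ α : Finset (Fin n × Col),
      α ∈ Y.faces ↔ ∃ c : Fin n → Col, IsProperColoring G L c ∧ α ⊆ colorFace c) ∧
  (∀ ω : Finset (Fin n × Col),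
      Y.pi ω =
        ∑ c : Fin n → Col,
          if IsProperColoring G L c ∧ ω = colorFace c then
            ((Finset.univ.filter fun c' : Fin n → Col =>
                IsProperColoring G L c').card : ℝ)⁻¹
          else 0)

end Coloring

/-! ## Ising models -/

section Ising

variable {n : ℕ}

/-- `±1` value of a Boolean spin. -/
def signR (b : Bool) : ℝ := if b then 1 else -1

/-- The (unnormalized) Ising weight `exp(½⟨x,Jx⟩ + ⟨h,x⟩)`. -/
def isingWeight (J : Matrix (Fin n) (Fin n) ℝ) (h : Fin n → ℝ) (x : Fin n → Bool) : ℝ :=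
  Real.exp ((1 / 2) * (∑ i, ∑ j, J i j * (signR (x i) * signR (x j))) +
    ∑ i, h i * signR (x i))

/-- The face `{(i, x i) : i}` associated to a spin configuration `x`. -/
def spinFace (x : Fin n → Bool) : Finset (Fin n × Bool) :=
  Finset.univ.image fun i => (i, x i)

/-- `Y` is the Ising complex of `(J, h)`. -/
def IsIsingComplex (J : Matrix (Fin n) (Fin n) ℝ) (h : Fin n → ℝ)
    (Y : WComplex (Fin n × Bool) n) : Prop :=
  (∀ α : Finset (Fin n × Bool), α ∈ Y.faces ↔ ∃ x : Fin n → Bool, α ⊆ spinFace x) ∧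
  (∀ ω : Finset (Fin n × Bool),
      Y.pi ω =
        (∑ x : Fin n → Bool, if ω = spinFace x then isingWeight J h x else 0) /
          ∑ x : Fin n → Bool, isingWeight J h x)

/-- The `ℓ₂ → ℓ₂` operator norm of a square matrix. -/
def matOpNorm {m : ℕ} (J : Matrix (Fin m) (Fin m) ℝ) : ℝ :=
  sSup {r | ∃ v : Fin m → ℝ, (∑ i, v i ^ 2) = 1 ∧
      r = Real.sqrt (∑ i, (J.mulVec v i) ^ 2)}

/-- The `2×2` principal submatrix of `J` at rows/columns `i, j`. -/
def principal2 (J : Matrix (Fin n) (Fin n) ℝ) (i j : Fin n) : Matrix (Fin 2) (Fin 2) ℝ :=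
  !![J i i, J i j; J j i, J j j]

/-- `‖h‖_∞`. -/
def normInf (h : Fin n → ℝ) : ℝ := sSup (Set.range fun i => |h i|)

/-- `‖h‖_₁`. -/
def norm1 (h : Fin n → ℝ) : ℝ := ∑ i, |h i|

end Ising

end Expanderized

namespace Expanderized

section Generic

variable {α β γ : Type*}

theorem mApp_matMul [Fintype β] [Fintype γ] (A : α → β → ℝ) (B : β → γ → ℝ) (f : γ → ℝ) :
    mApp (matMul A B) f = mApp A (mApp B f) := by
  funext x
  simp only [mApp, matMul, Finset.sum_mul, Finset.mul_sum]
  rw [Finset.sum_comm]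
  exact Finset.sum_congr rfl fun y _ => Finset.sum_congr rfl fun z _ => by ring

theorem mApp_smul [Fintype β] (P : α → β → ℝ) (c : ℝ) (f : β → ℝ) :
    mApp P (fun x => c * f x) = fun x => c * mApp P f x := by
  funext x
  simp only [mApp, Finset.mul_sum]
  exact Finset.sum_congr rfl fun y _ => by ring

variable [Fintype α] [Fintype β]

/-- `A` and `B` are mutually adjoint kernels for the weights `μ` and `ν`, and both are
row-stochastic on the support of the respective weight. -/
structure IsAdjointPair (μ : α → ℝ) (ν : β → ℝ) (A : α → β → ℝ) (B : β → α → ℝ) : Prop where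
  nonneg : ∀ x y, 0 ≤ μ x * A x y
  adj : ∀ x y, μ x * A x y = ν y * B y x
  sum_left : ∀ x, ∑ y, μ x * A x y = μ x
  sum_right : ∀ y, ∑ x, ν y * B y x = ν y

namespace IsAdjointPair

variable {μ : α → ℝ} {ν : β → ℝ} {A : α → β → ℝ} {B : β → α → ℝ}

theorem symm (h : IsAdjointPair μ ν A B) : IsAdjointPair ν μ B A where
  nonneg y x := h.adj x y ▸ h.nonneg x y
  adj y x := (h.adj x y).symm
  sum_left := h.sum_right
  sum_right := h.sum_left

theorem weight_nonneg (h : IsAdjointPair μ ν A B) (x : α) : 0 ≤ μ x :=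
  h.sum_left x ▸ Finset.sum_nonneg fun y _ => h.nonneg x y

end IsAdjointPair

theorem inner'_mApp (μ : α → ℝ) (P : α → β → ℝ) (f : α → ℝ) (g : β → ℝ) :
    inner' μ f (mApp P g) = ∑ x, ∑ y, μ x * P x y * (f x * g y) := by
  unfold inner' mApp
  refine Finset.sum_congr rfl fun x _ => ?_
  rw [Finset.mul_sum, Finset.mul_sum]
  exact Finset.sum_congr rfl fun y _ => by ring

theorem inner'_comm (μ : α → ℝ) (f g : α → ℝ) : inner' μ f g = inner' μ g f :=
  Finset.sum_congr rfl fun x _ => by ring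

theorem inner'_self_nonneg {μ : α → ℝ} (hμ : ∀ x, 0 ≤ μ x) (f : α → ℝ) : 0 ≤ inner' μ f f :=
  Finset.sum_nonneg fun x _ => mul_nonneg (hμ x) (mul_self_nonneg _)

theorem inner'_mApp_adj {μ : α → ℝ} {ν : β → ℝ} {A : α → β → ℝ} {B : β → α → ℝ}
    (hadj : ∀ x y, μ x * A x y = ν y * B y x) (f : α → ℝ) (g : β → ℝ) :
    inner' μ f (mApp A g) = inner' ν g (mApp B f) := by
  rw [inner'_mApp, inner'_mApp, Finset.sum_comm]
  exact Finset.sum_congr rfl fun y _ => Finset.sum_congr rfl fun x _ => by rw [hadj]; ring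

theorem inner'_mul_self_le {μ : α → ℝ} (hμ : ∀ x, 0 ≤ μ x) (f g : α → ℝ) :
    inner' μ f g ^ 2 ≤ inner' μ f f * inner' μ g g := by
  have h := Finset.sum_mul_sq_le_sq_mul_sq Finset.univ
    (fun x => √(μ x) * f x) (fun x => √(μ x) * g x)
  have e : ∀ u v : α → ℝ, ∑ x, (√(μ x) * u x) * (√(μ x) * v x) = inner' μ u v := fun u v =>
    Finset.sum_congr rfl fun x _ => by
      rw [mul_mul_mul_comm, Real.mul_self_sqrt (hμ x)]
  simpa only [pow_two, e] using h

namespace IsAdjointPair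

variable {μ : α → ℝ} {ν : β → ℝ} {A : α → β → ℝ} {B : β → α → ℝ}

theorem matMul_self (h : IsAdjointPair μ ν A B) :
    IsAdjointPair μ μ (matMul A B) (matMul A B) := by
  have e : ∀ x z, μ x * matMul A B x z = ∑ y, ν y * B y x * B y z := fun x z => by
    rw [matMul, Finset.mul_sum]
    exact Finset.sum_congr rfl fun y _ => by rw [← h.adj]; ring
  have e' : ∀ x z, μ x * matMul A B x z = μ z * matMul A B z x := fun x z => by
    rw [e, e]
    exact Finset.sum_congr rfl fun y _ => by ring
  have s : ∀ x, ∑ z, μ x * matMul A B x z = μ x := fun x => by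
    simp only [e]
    rw [Finset.sum_comm]
    conv_rhs => rw [← h.sum_left x]
    refine Finset.sum_congr rfl fun y _ => ?_
    rw [h.adj]
    have : ∀ z, ν y * B y x * B y z = B y x * (ν y * B y z) := fun z => by ring
    simp only [this]
    rw [← Finset.mul_sum, h.sum_right, mul_comm]
  refine ⟨fun x z => ?_, e', s, s⟩
  rw [e]
  refine Finset.sum_nonneg fun y _ => ?_
  rcases (h.symm.weight_nonneg y).eq_or_lt with h0 | h0
  · simp [← h0]
  · have hz : 0 ≤ B y z := by
      have := h.symm.nonneg y z
      exact nonneg_of_mul_nonneg_right this h0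
    exact mul_nonneg (h.symm.nonneg y x) hz

theorem inner'_matMul_nonneg (h : IsAdjointPair μ ν A B) (f : α → ℝ) :
    0 ≤ inner' μ f (mApp (matMul A B) f) := by
  rw [mApp_matMul, inner'_mApp_adj h.adj]
  exact inner'_self_nonneg h.symm.weight_nonneg _

theorem lambda2_nonneg (h : IsAdjointPair μ ν A B) : 0 ≤ lambda2 μ (matMul A B) := by
  refine Real.sSup_nonneg ?_
  rintro r ⟨f, -, -, rfl⟩
  exact h.inner'_matMul_nonneg f

theorem abs_inner'_le {P : α → α → ℝ} (h : IsAdjointPair μ μ P P) (f : α → ℝ) :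
    |inner' μ f (mApp P f)| ≤ inner' μ f f := by
  rw [inner'_mApp]
  have h1 : ∑ x, ∑ y, μ x * P x y * (f x ^ 2) = inner' μ f f := by
    refine Finset.sum_congr rfl fun x _ => ?_
    rw [← Finset.sum_mul, h.sum_left, pow_two]
  have h2 : ∑ x, ∑ y, μ x * P x y * (f y ^ 2) = inner' μ f f := by
    rw [← h1, Finset.sum_comm]
    exact Finset.sum_congr rfl fun x _ => Finset.sum_congr rfl fun y _ => by rw [h.adj]
  calc |∑ x, ∑ y, μ x * P x y * (f x * f y)|
      ≤ ∑ x, ∑ y, |μ x * P x y * (f x * f y)| :=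
        (Finset.abs_sum_le_sum_abs _ _).trans
          (Finset.sum_le_sum fun x _ => Finset.abs_sum_le_sum_abs _ _)
    _ ≤ ∑ x, ∑ y, (μ x * P x y * (f x ^ 2) + μ x * P x y * (f y ^ 2)) / 2 := by
        refine Finset.sum_le_sum fun x _ => Finset.sum_le_sum fun y _ => ?_
        rw [abs_mul, abs_of_nonneg (h.nonneg x y), ← mul_add, mul_div_assoc]
        refine mul_le_mul_of_nonneg_left ?_ (h.nonneg x y)
        rw [abs_le]
        constructor <;> nlinarith [sq_nonneg (f x + f y), sq_nonneg (f x - f y)]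
    _ = inner' μ f f := by
        simp only [← Finset.sum_div, Finset.sum_add_distrib]
        rw [h1, h2]; ring

end IsAdjointPair

theorem inner'_smul_smul (μ : α → ℝ) (c : ℝ) (f g : α → ℝ) :
    inner' μ (fun x => c * f x) (fun x => c * g x) = c ^ 2 * inner' μ f g := by
  unfold inner'
  rw [Finset.mul_sum]
  exact Finset.sum_congr rfl fun x _ => by ring

/-- A quadratic functional is bounded by its supremum over the unit sphere orthogonal to
the constants. -/
theorem le_sSup_mul_inner' {μ : α → ℝ} {q : (α → ℝ) → ℝ} (hμ : ∀ x, 0 ≤ μ x)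
    (hq : ∀ c f, q (fun x => c * f x) = c ^ 2 * q f) (hle : ∀ f, q f ≤ inner' μ f f)
    {f : α → ℝ} (hf : inner' μ f (fun _ => 1) = 0) :
    q f ≤ sSup {r | ∃ f : α → ℝ, inner' μ f f = 1 ∧ inner' μ f (fun _ => 1) = 0 ∧ r = q f} *
      inner' μ f f := by
  rcases (inner'_self_nonneg hμ f).eq_or_lt with h0 | h0
  · simpa [← h0] using hle f
  · have hs : (√(inner' μ f f))⁻¹ ^ 2 = (inner' μ f f)⁻¹ := by
      rw [inv_pow, Real.sq_sqrt h0.le]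
    rw [← div_le_iff₀ h0]
    refine le_csSup ⟨1, ?_⟩ ⟨fun x => (√(inner' μ f f))⁻¹ * f x, ?_, ?_, ?_⟩
    · rintro r ⟨g, hg, -, rfl⟩
      exact hg ▸ hle g
    · rw [inner'_smul_smul, hs, inv_mul_cancel₀ h0.ne']
    · have : inner' μ (fun x => (√(inner' μ f f))⁻¹ * f x) (fun _ => 1) =
          (√(inner' μ f f))⁻¹ * inner' μ f (fun _ => 1) := by
        unfold inner'
        rw [Finset.mul_sum]
        exact Finset.sum_congr rfl fun x _ => by ring
      rw [this, hf, mul_zero]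
    · rw [hq, hs, div_eq_inv_mul]

namespace IsAdjointPair

variable {μ : α → ℝ} {P : α → α → ℝ}

theorem inner'_le_lambda2 (h : IsAdjointPair μ μ P P) {f : α → ℝ}
    (hf : inner' μ f (fun _ => 1) = 0) :
    inner' μ f (mApp P f) ≤ lambda2 μ P * inner' μ f f :=
  le_sSup_mul_inner' (q := fun f => inner' μ f (mApp P f)) h.weight_nonneg
    (fun c f => by rw [mApp_smul, inner'_smul_smul])
    (fun f => (le_abs_self _).trans (h.abs_inner'_le f)) hf

theorem inner'_le_twoSided (h : IsAdjointPair μ μ P P) {f : α → ℝ}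
    (hf : inner' μ f (fun _ => 1) = 0) :
    inner' μ f (mApp P f) ≤ twoSided μ P * inner' μ f f :=
  (le_abs_self _).trans <|
    le_sSup_mul_inner' (q := fun f => |inner' μ f (mApp P f)|) h.weight_nonneg
      (fun c f => by rw [mApp_smul, inner'_smul_smul, abs_mul, abs_of_nonneg (sq_nonneg c)])
      h.abs_inner'_le hf

theorem twoSided_le_one (h : IsAdjointPair μ μ P P) : twoSided μ P ≤ 1 := by
  refine Real.sSup_le ?_ zero_le_one
  rintro r ⟨f, hf, -, rfl⟩
  exact hf ▸ h.abs_inner'_le f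

end IsAdjointPair

theorem twoSided_nonneg (μ : α → ℝ) (P : α → α → ℝ) : 0 ≤ twoSided μ P := by
  refine Real.sSup_nonneg ?_
  rintro r ⟨f, -, -, rfl⟩
  exact abs_nonneg _

theorem lambda2_le {μ : α → ℝ} {P : α → α → ℝ} {c : ℝ} (hc : 0 ≤ c)
    (h : ∀ f, inner' μ f (fun _ => 1) = 0 → inner' μ f (mApp P f) ≤ c * inner' μ f f) :
    lambda2 μ P ≤ c := by
  refine Real.sSup_le ?_ hc
  rintro r ⟨f, hf, hmean, rfl⟩
  simpa [hf] using h f hmean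

/-- A Rayleigh quotient bound for `BA` transfers to `AB` when `A` and `B` are adjoint. -/
theorem inner'_matMul_le_of_swap {μ : α → ℝ} {ν : β → ℝ} {A : α → β → ℝ} {B : β → α → ℝ}
    (hμ : ∀ x, 0 ≤ μ x) (hν : ∀ y, 0 ≤ ν y)
    (hadj : ∀ x y, μ x * A x y = ν y * B y x) (hsum : ∀ x, ∑ y, μ x * A x y = μ x)
    {c : ℝ} (hc : 0 ≤ c)
    (h : ∀ g, inner' ν g (fun _ => 1) = 0 →
      inner' ν g (mApp (matMul B A) g) ≤ c * inner' ν g g)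
    {f : α → ℝ} (hf : inner' μ f (fun _ => 1) = 0) :
    inner' μ f (mApp (matMul A B) f) ≤ c * inner' μ f f := by
  have hg : inner' ν (mApp B f) (fun _ => 1) = 0 := by
    rw [inner'_comm, ← inner'_mApp_adj hadj, inner'_mApp, ← hf]
    exact Finset.sum_congr rfl fun x _ => by rw [← Finset.sum_mul, hsum]
  have h1 := h _ hg
  rw [mApp_matMul, ← inner'_mApp_adj hadj, inner'_comm] at h1
  have h2 := inner'_mul_self_le hμ f (mApp A (mApp B f))
  rw [mApp_matMul]
  rw [inner'_mApp_adj hadj f] at h2 ⊢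
  have h3 := inner'_self_nonneg hμ f
  have h4 := inner'_self_nonneg hν (mApp B f)
  rcases h4.eq_or_lt with h0 | h0
  · rw [← h0]; positivity
  · refine le_of_mul_le_mul_right ?_ h0
    nlinarith [mul_le_mul_of_nonneg_left h1 h3]

theorem IsAdjointPair.inner'_const_mApp {μ : α → ℝ} {W : α → α → ℝ}
    (h : IsAdjointPair μ μ W W) (f : α → ℝ) :
    inner' μ (fun _ => 1) (mApp W f) = inner' μ f (fun _ => 1) := by
  rw [inner'_mApp_adj h.adj, inner'_mApp]
  exact Finset.sum_congr rfl fun x _ => by rw [← Finset.sum_mul, h.sum_left]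

/-- The expansion bound on a function, split into its mean and its mean-zero part. -/
theorem IsAdjointPair.inner'_le_twoSided_add_mean {μ : α → ℝ} {W : α → α → ℝ}
    (h : IsAdjointPair μ μ W W) (hμ : ∑ x, μ x = 1) (f : α → ℝ) :
    inner' μ f (mApp W f) ≤
      twoSided μ W * inner' μ f f + (1 - twoSided μ W) * inner' μ f (fun _ => 1) ^ 2 := by
  set m := inner' μ f (fun _ => 1) with hm
  have h11 : inner' μ (fun _ => 1) (fun _ => 1) = 1 := by simpa [inner'] using hμ
  have split : ∀ u : α → ℝ, inner' μ (fun x => f x + -m * 1) u =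
      inner' μ f u - m * inner' μ (fun _ => 1) u := fun u => by
    unfold inner'
    rw [Finset.mul_sum, ← Finset.sum_sub_distrib]
    exact Finset.sum_congr rfl fun x _ => by ring
  have hg : inner' μ (fun x => f x + -m * 1) (fun _ => 1) = 0 := by
    rw [split, h11, ← hm]; ring
  have hgg : inner' μ (fun x => f x + -m * 1) (fun x => f x + -m * 1) =
      inner' μ f f - m ^ 2 := by
    rw [split, inner'_comm μ f, split, inner'_comm μ (fun _ => 1) (fun x => f x + -m * 1), hg,
      inner'_comm μ (fun _ => 1) f, ← hm]
    ring
  have hgW : inner' μ (fun x => f x + -m * 1) (mApp W (fun x => f x + -m * 1)) =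
      inner' μ f (mApp W f) - m ^ 2 := by
    rw [split, h.inner'_const_mApp, hg, inner'_mApp_adj h.adj, split, h.inner'_const_mApp, ← hm]
    ring
  have := h.inner'_le_twoSided hg
  rw [hgg, hgW] at this
  linarith

end Generic

section Complex

variable {V : Type*} [Fintype V] [DecidableEq V] {n : ℕ} (K : WComplex V n)

theorem pi_nonneg (ω : Finset V) : 0 ≤ K.pi ω := by
  by_cases h : ω ∈ K.faces
  · by_cases h' : ω.card = n
    · exact (K.pi_pos ω h h').le
    · rw [K.pi_zero_of_card_ne ω h']
  · rw [K.pi_zero_of_not_mem ω h]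

variable {K} in
theorem card_of_pi_ne_zero {ω : Finset V} (h : K.pi ω ≠ 0) : ω.card = n :=
  of_not_not fun h' => h (K.pi_zero_of_card_ne ω h')

variable {K} in
theorem mem_of_pi_ne_zero {ω : Finset V} (h : K.pi ω ≠ 0) : ω ∈ K.faces :=
  of_not_not fun h' => h (K.pi_zero_of_not_mem ω h')

theorem mass_nonneg (a : Finset V) : 0 ≤ K.mass a :=
  Finset.sum_nonneg fun ω _ => by split_ifs <;> simp [pi_nonneg]

variable {K} in
theorem pi_eq_zero_of_mass_eq_zero {a ω : Finset V} (h : K.mass a = 0) (ha : a ⊆ ω) :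
    K.pi ω = 0 := by
  have := (Finset.sum_eq_zero_iff_of_nonneg
    (fun ω _ => by split_ifs <;> simp [pi_nonneg])).1 h ω (Finset.mem_univ _)
  simpa [ha] using this

theorem mass_of_card_eq {a : Finset V} (ha : a.card = n) : K.mass a = K.pi a := by
  unfold WComplex.mass
  rw [Finset.sum_eq_single a]
  · simp
  · intro ω _ hω
    split_ifs with h
    · refine K.pi_zero_of_card_ne ω fun h' => hω ?_
      exact (Finset.eq_of_subset_of_card_le h (by omega)).symm
    · rfl
  · simp

end Complex

section Partite

variable {n : ℕ} {U : Type*} [Fintype U] [DecidableEq U] {K : WComplex (Fin n × U) n}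

theorem injOn_fst (hpart : IsPartite K) {ω : Finset (Fin n × U)} (hω : K.pi ω ≠ 0) :
    Set.InjOn Prod.fst (ω : Set (Fin n × U)) := by
  rw [← Finset.card_image_iff]
  have h := hpart ω (mem_of_pi_ne_zero hω) (card_of_pi_ne_zero hω)
  rw [card_of_pi_ne_zero hω]
  exact h

theorem card_typ_of_subset (hpart : IsPartite K) {a ω : Finset (Fin n × U)} (hω : K.pi ω ≠ 0)
    (ha : a ⊆ ω) : (typ a).card = a.card :=
  Finset.card_image_iff.2 ((injOn_fst hpart hω).mono (by exact_mod_cast ha))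

theorem restrict_typ_eq_iff (hpart : IsPartite K) {a ω : Finset (Fin n × U)}
    (hω : K.pi ω ≠ 0) : restrict ω (typ a) = a ↔ a ⊆ ω := by
  constructor
  · intro h
    rw [← h]
    exact Finset.filter_subset _ _
  · intro h
    ext v
    simp only [restrict, typ, Finset.mem_filter, Finset.mem_image]
    constructor
    · rintro ⟨hv, w, hw, hwv⟩
      rwa [← injOn_fst hpart hω (h hw) hv hwv]
    · exact fun hv => ⟨h hv, v, hv, rfl⟩

theorem typ_restrict (hpart : IsPartite K) {ω : Finset (Fin n × U)} (hω : K.pi ω ≠ 0)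
    (S : Finset (Fin n)) : typ (restrict ω S) = S := by
  have h : typ ω = Finset.univ := by
    rw [← Finset.card_eq_iff_eq_univ, Fintype.card_fin]
    exact hpart ω (mem_of_pi_ne_zero hω) (card_of_pi_ne_zero hω)
  ext i
  simp only [restrict, typ, Finset.mem_filter, Finset.mem_image]
  constructor
  · rintro ⟨v, ⟨-, hv⟩, rfl⟩
    exact hv
  · intro hi
    obtain ⟨v, hv, rfl⟩ := Finset.mem_image.1 (h ▸ Finset.mem_univ i : i ∈ typ ω)
    exact ⟨v, ⟨hv, hi⟩, rfl⟩

/-- Summing over the sub-faces of a facet is the same as summing over types. -/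
theorem sum_subset_eq (hpart : IsPartite K) {ω : Finset (Fin n × U)} (hω : K.pi ω ≠ 0)
    (g : Finset (Fin n × U) → ℝ) :
    ∑ a, (if a ⊆ ω then g a else 0) = ∑ S, g (restrict ω S) := by
  rw [← Finset.sum_filter]
  refine Finset.sum_bij' (fun a _ => typ a) (fun S _ => restrict ω S) (fun _ _ => Finset.mem_univ _)
    (fun S _ => ?_) (fun a ha => ?_) (fun S _ => typ_restrict hpart hω S) (fun a ha => ?_)
  · exact Finset.mem_filter.2 ⟨Finset.mem_univ _, Finset.filter_subset _ ω⟩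
  · exact (restrict_typ_eq_iff hpart hω).2 (Finset.mem_filter.1 ha).2
  · rw [(restrict_typ_eq_iff hpart hω).2 (Finset.mem_filter.1 ha).2]

theorem jointMass_eq (hpart : IsPartite K) (a b : Finset (Fin n × U)) :
    jointMass K a b = ∑ ω, K.pi ω * ((if a ⊆ ω then 1 else 0) * (if b ⊆ ω then 1 else 0)) := by
  refine Finset.sum_congr rfl fun ω _ => ?_
  by_cases hω : K.pi ω = 0
  · simp [hω]
  · simp only [restrict_typ_eq_iff hpart hω]
    by_cases ha : a ⊆ ω <;> by_cases hb : b ⊆ ω <;> simp [ha, hb]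

theorem jointMass_self (hpart : IsPartite K) (a : Finset (Fin n × U)) :
    jointMass K a a = K.mass a := by
  rw [jointMass_eq hpart]
  exact Finset.sum_congr rfl fun ω _ => by by_cases ha : a ⊆ ω <;> simp [ha]

theorem jointMass_eq_zero (hpart : IsPartite K) {a : Finset (Fin n × U)} (h : K.mass a = 0)
    (b : Finset (Fin n × U)) : jointMass K a b = 0 := by
  rw [jointMass_eq hpart]
  refine Finset.sum_eq_zero fun ω _ => ?_
  by_cases ha : a ⊆ ω
  · simp [pi_eq_zero_of_mass_eq_zero h ha]
  · simp [ha]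

theorem level_eq (hpart : IsPartite K) (ℓ : ℕ) (a : Finset (Fin n × U)) :
    K.level ℓ a = K.mass a * unifSubsets n ℓ (typ a) := by
  by_cases h : K.mass a = 0
  · simp [WComplex.level, h]
  · obtain ⟨ω, -, hω⟩ := Finset.exists_ne_zero_of_sum_ne_zero h
    obtain ⟨ha, hω⟩ : a ⊆ ω ∧ K.pi ω ≠ 0 := by simpa using hω
    simp only [WComplex.level, unifSubsets, card_typ_of_subset hpart hω ha]
    split_ifs <;> ring

theorem unifSubsets_nonneg (n ℓ : ℕ) (S : Finset (Fin n)) : 0 ≤ unifSubsets n ℓ S := by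
  unfold unifSubsets
  split_ifs <;> positivity

theorem sum_unifSubsets {n ℓ : ℕ} (hℓ : ℓ ≤ n) : ∑ S, unifSubsets n ℓ S = 1 := by
  have h : (n.choose ℓ : ℝ) ≠ 0 := by exact_mod_cast (Nat.choose_pos hℓ).ne'
  have h' : (Finset.univ.filter fun S : Finset (Fin n) => S.card = ℓ).card = n.choose ℓ := by
    rw [← Finset.powerset_univ, ← Finset.powersetCard_eq_filter, Finset.card_powersetCard, Finset.card_fin]
  simp only [unifSubsets]
  rw [← Finset.sum_filter, Finset.sum_const, h', nsmul_eq_mul, mul_inv_cancel₀ h]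

theorem level_nonneg (hpart : IsPartite K) (ℓ : ℕ) (a : Finset (Fin n × U)) :
    0 ≤ K.level ℓ a := by
  rw [level_eq hpart]
  exact mul_nonneg (mass_nonneg K a) (unifSubsets_nonneg n ℓ _)

theorem sum_mass_mul (hpart : IsPartite K) (φ : Finset (Fin n × U) → ℝ) :
    ∑ a, K.mass a * φ a = ∑ ω, K.pi ω * ∑ S, φ (restrict ω S) := by
  simp only [WComplex.mass, Finset.sum_mul]
  rw [Finset.sum_comm]
  refine Finset.sum_congr rfl fun ω _ => ?_
  by_cases hω : K.pi ω = 0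
  · simp [hω]
  · rw [← sum_subset_eq hpart hω, Finset.mul_sum]
    exact Finset.sum_congr rfl fun a _ => by split_ifs <;> simp

theorem sum_jointMass_mul (hpart : IsPartite K)
    (φ : Finset (Fin n × U) → Finset (Fin n × U) → ℝ) :
    ∑ a, ∑ b, jointMass K a b * φ a b =
      ∑ ω, K.pi ω * ∑ S, ∑ T, φ (restrict ω S) (restrict ω T) := by
  have h : ∀ a, ∑ b, jointMass K a b * φ a b =
      ∑ ω, K.pi ω * (if a ⊆ ω then ∑ b, if b ⊆ ω then φ a b else 0 else 0) := fun a => by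
    simp only [jointMass_eq hpart, Finset.sum_mul]
    rw [Finset.sum_comm]
    refine Finset.sum_congr rfl fun ω _ => ?_
    split_ifs with ha
    · rw [Finset.mul_sum]
      exact Finset.sum_congr rfl fun b _ => by split_ifs <;> simp
    · simp
  simp only [h]
  rw [Finset.sum_comm]
  refine Finset.sum_congr rfl fun ω _ => ?_
  by_cases hω : K.pi ω = 0
  · simp [hω]
  · rw [← Finset.mul_sum, sum_subset_eq hpart hω]
    simp only [sum_subset_eq hpart hω]

theorem inner'_level (hpart : IsPartite K) (ℓ : ℕ) (f g : Finset (Fin n × U) → ℝ) :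
    inner' (K.level ℓ) f g = ∑ ω, K.pi ω * inner' (unifSubsets n ℓ)
      (fun S => f (restrict ω S)) (fun S => g (restrict ω S)) := by
  unfold inner'
  simp only [level_eq hpart, mul_assoc]
  rw [sum_mass_mul hpart]
  refine Finset.sum_congr rfl fun ω _ => ?_
  by_cases hω : K.pi ω = 0
  · simp [hω]
  · simp only [typ_restrict hpart hω]

/-- A kernel on level `ℓ` that resamples types by `W` has a quadratic form which is an
average over facets of the quadratic form of `W`. -/
theorem inner'_level_mApp (hpart : IsPartite K) (ℓ : ℕ)
    {P : Finset (Fin n × U) → Finset (Fin n × U) → ℝ}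
    {W : Finset (Fin n) → Finset (Fin n) → ℝ}
    (hP : ∀ a b, K.level ℓ a * P a b =
      jointMass K a b * (unifSubsets n ℓ (typ a) * W (typ a) (typ b)))
    (f : Finset (Fin n × U) → ℝ) :
    inner' (K.level ℓ) f (mApp P f) = ∑ ω, K.pi ω * inner' (unifSubsets n ℓ)
      (fun S => f (restrict ω S)) (mApp W fun S => f (restrict ω S)) := by
  simp only [inner'_mApp, hP, mul_assoc]
  rw [sum_jointMass_mul hpart]
  refine Finset.sum_congr rfl fun ω _ => ?_
  by_cases hω : K.pi ω = 0
  · simp [hω]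
  · simp only [typ_restrict hpart hω]

theorem level_mul_expUpDown (hpart : IsPartite K) (ℓ : ℕ)
    (W : Finset (Fin n) → Finset (Fin n) → ℝ) (a b : Finset (Fin n × U)) :
    K.level ℓ a * expUpDown K W a b =
      jointMass K a b * (unifSubsets n ℓ (typ a) * W (typ a) (typ b)) := by
  rw [level_eq hpart, expUpDown, jointMass_self hpart]
  by_cases h : K.mass a = 0
  · simp [h, jointMass_eq_zero hpart h]
  · field_simp

theorem down_eq (hpart : IsPartite K) (ℓ : ℕ) {ω : Finset (Fin n × U)} (hω : K.pi ω ≠ 0)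
    (b : Finset (Fin n × U)) :
    K.down n ℓ ω b = if b ⊆ ω then unifSubsets n ℓ (typ b) else 0 := by
  by_cases hb : b ⊆ ω
  · simp [WComplex.down, unifSubsets, hb, card_typ_of_subset hpart hω hb, card_of_pi_ne_zero hω]
  · simp [WComplex.down, hb]

theorem isAdjointPair_down_up (hpart : IsPartite K) {ℓ : ℕ} (hℓ : ℓ ≤ n) :
    IsAdjointPair K.pi (K.level ℓ) (K.down n ℓ) (K.up ℓ n) := by
  have hdown : ∀ ω b, K.pi ω * K.down n ℓ ω b =
      if b ⊆ ω then K.pi ω * unifSubsets n ℓ (typ b) else 0 := fun ω b => by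
    by_cases hω : K.pi ω = 0
    · simp [hω]
    · rw [down_eq hpart ℓ hω]
      split_ifs <;> simp
  have hadj : ∀ ω b, K.pi ω * K.down n ℓ ω b = K.level ℓ b * K.up ℓ n b ω := fun ω b => by
    by_cases hn : ω.card = n
    · by_cases hb : b.card = ℓ ∧ b ⊆ ω
      · by_cases hm : K.mass b = 0
        · simp [WComplex.level, hm, pi_eq_zero_of_mass_eq_zero hm hb.2]
        · simp only [WComplex.down, WComplex.level, WComplex.up, hn, hb, mass_of_card_eq K hn,
            and_self, if_true, Nat.choose_self, Nat.cast_one, inv_one]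
          field_simp
      · have h1 : ¬ (ω.card = n ∧ b.card = ℓ ∧ b ⊆ ω) := fun h => hb h.2
        have h2 : ¬ (b.card = ℓ ∧ ω.card = n ∧ b ⊆ ω) := fun h => hb ⟨h.1, h.2.2⟩
        simp [WComplex.down, WComplex.up, h1, h2]
    · simp [WComplex.down, WComplex.up, hn]
  refine ⟨fun ω b => ?_, hadj, fun ω => ?_, fun b => ?_⟩
  · rw [hdown]
    split_ifs
    · exact mul_nonneg (pi_nonneg K ω) (unifSubsets_nonneg n ℓ _)
    · exact le_rfl
  · by_cases hω : K.pi ω = 0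
    · simp [hω]
    · simp only [hdown]
      rw [sum_subset_eq hpart hω]
      simp only [typ_restrict hpart hω]
      rw [← Finset.mul_sum, sum_unifSubsets hℓ, mul_one]
  · simp only [← hadj, hdown]
    rw [level_eq hpart, WComplex.mass, Finset.sum_mul]
    exact Finset.sum_congr rfl fun ω _ => by split_ifs <;> simp

theorem level_mul_upDown (hpart : IsPartite K) {ℓ : ℕ} (hℓ : ℓ ≤ n)
    (a b : Finset (Fin n × U)) :
    K.level ℓ a * K.upDown ℓ a b =
      jointMass K a b * (unifSubsets n ℓ (typ a) * unifSubsets n ℓ (typ b)) := by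
  rw [WComplex.upDown, matMul, Finset.mul_sum, jointMass_eq hpart, Finset.sum_mul]
  refine Finset.sum_congr rfl fun ω _ => ?_
  rw [← mul_assoc, ← (isAdjointPair_down_up hpart hℓ).adj]
  by_cases hω : K.pi ω = 0
  · simp [hω]
  · rw [down_eq hpart ℓ hω, down_eq hpart ℓ hω]
    by_cases ha : a ⊆ ω <;> by_cases hb : b ⊆ ω <;> simp [ha, hb]
    ring

/-- A Rayleigh quotient bound for the up-down walk yields one for its expanderization. -/
theorem inner'_expUpDown_le (hpart : IsPartite K) {ℓ : ℕ} (hℓ : ℓ ≤ n)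
    {W : Finset (Fin n) → Finset (Fin n) → ℝ}
    (hW : IsAdjointPair (unifSubsets n ℓ) (unifSubsets n ℓ) W W) {c : ℝ}
    (hc : ∀ f, inner' (K.level ℓ) f (fun _ => 1) = 0 →
      inner' (K.level ℓ) f (mApp (K.upDown ℓ) f) ≤ c * inner' (K.level ℓ) f f)
    {f : Finset (Fin n × U) → ℝ} (hf : inner' (K.level ℓ) f (fun _ => 1) = 0) :
    inner' (K.level ℓ) f (mApp (expUpDown K W) f) ≤
      (twoSided (unifSubsets n ℓ) W + (1 - twoSided (unifSubsets n ℓ) W) * c) *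
        inner' (K.level ℓ) f f := by
  set t := twoSided (unifSubsets n ℓ) W
  have hmean : inner' (K.level ℓ) f (mApp (K.upDown ℓ) f) =
      ∑ ω, K.pi ω * inner' (unifSubsets n ℓ) (fun S => f (restrict ω S)) (fun _ => 1) ^ 2 := by
    rw [inner'_level_mApp hpart ℓ (W := fun _ T => unifSubsets n ℓ T) (level_mul_upDown hpart hℓ)]
    refine Finset.sum_congr rfl fun ω _ => ?_
    congr 1
    simp only [inner', mApp, mul_one, ← mul_assoc]
    rw [← Finset.sum_mul, pow_two]
  have h1 : inner' (K.level ℓ) f (mApp (expUpDown K W) f) ≤ t * inner' (K.level ℓ) f f +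
      (1 - t) * inner' (K.level ℓ) f (mApp (K.upDown ℓ) f) := by
    rw [inner'_level_mApp hpart ℓ (level_mul_expUpDown hpart ℓ W), hmean, inner'_level hpart,
      Finset.mul_sum, Finset.mul_sum, ← Finset.sum_add_distrib]
    refine Finset.sum_le_sum fun ω _ => ?_
    have := mul_le_mul_of_nonneg_left
      (hW.inner'_le_twoSided_add_mean (sum_unifSubsets hℓ) fun S => f (restrict ω S))
      (pi_nonneg K ω)
    refine this.trans_eq ?_
    ring
  have h2 := mul_le_mul_of_nonneg_left (hc f hf) (sub_nonneg.2 hW.twoSided_le_one)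
  linarith

theorem isAdjointPair_walkMat {H : SimpleGraph (Finset (Fin n))} {ℓ k : ℕ}
    (hreg : IsRegularOnSubsets H ℓ k) (hk : 0 < k) :
    IsAdjointPair (unifSubsets n ℓ) (unifSubsets n ℓ) (walkMat H k) (walkMat H k) := by
  have hk' : (k : ℝ) ≠ 0 := by exact_mod_cast hk.ne'
  have hadj : ∀ S T, unifSubsets n ℓ S * walkMat H k S T =
      unifSubsets n ℓ T * walkMat H k T S := fun S T => by
    by_cases h : H.Adj S T
    · simp [walkMat, unifSubsets, h, h.symm, hreg.1 S T h]
    · simp [walkMat, h, mt SimpleGraph.Adj.symm h]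
  have hsum : ∀ S, ∑ T, unifSubsets n ℓ S * walkMat H k S T = unifSubsets n ℓ S := fun S => by
    by_cases h : S.card = ℓ
    · rw [← Finset.mul_sum]
      simp only [walkMat]
      rw [← Finset.sum_filter, Finset.sum_const, hreg.2 S h, nsmul_eq_mul, mul_inv_cancel₀ hk',
        mul_one]
    · simp [unifSubsets, h]
  refine ⟨fun S T => mul_nonneg (unifSubsets_nonneg n ℓ S) ?_, hadj, hsum, hsum⟩
  unfold walkMat
  split_ifs <;> positivity

theorem Qdown_eq (H : SimpleGraph (Finset (Fin n))) (k : ℕ)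
    (p : Finset (Fin n × U) × Finset (Fin n)) (b : Finset (Fin n × U)) :
    Qdown K H k p b = if b ⊆ p.1 then walkMat H k p.2 (typ b) else 0 := by
  by_cases hb : b ⊆ p.1 <;> simp [Qdown, walkMat, hb]

theorem Qup_eq (H : SimpleGraph (Finset (Fin n))) (k : ℕ)
    (b : Finset (Fin n × U)) (p : Finset (Fin n × U) × Finset (Fin n)) :
    Qup K H k b p = walkMat H k (typ b) p.2 * ((if b ⊆ p.1 then K.pi p.1 else 0) / K.mass b) := by
  simp only [Qup, walkMat, H.adj_comm]

theorem matMul_Qup_Qdown (hpart : IsPartite K) (H : SimpleGraph (Finset (Fin n))) (k : ℕ) :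
    matMul (Qup K H k) (Qdown K H k) = expUpDown K (matMul (walkMat H k) (walkMat H k)) := by
  funext a b
  simp only [matMul, expUpDown, jointMass_self hpart, Qup_eq, Qdown_eq, jointMass_eq hpart,
    Fintype.sum_prod_type]
  rw [Finset.sum_div, Finset.mul_sum]
  refine Finset.sum_congr rfl fun ω _ => ?_
  rw [Finset.sum_mul]
  refine Finset.sum_congr rfl fun S _ => ?_
  split_ifs <;> ring

theorem prodDist_mul_Qdown (hpart : IsPartite K) {H : SimpleGraph (Finset (Fin n))} {ℓ k : ℕ}
    (hreg : IsRegularOnSubsets H ℓ k) (hk : 0 < k)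
    (p : Finset (Fin n × U) × Finset (Fin n)) (b : Finset (Fin n × U)) :
    prodDist K ℓ p * Qdown K H k p b = K.level ℓ b * Qup K H k b p := by
  rw [prodDist, Qdown_eq, level_eq hpart, Qup_eq]
  split_ifs with hb
  · rw [mul_assoc, (isAdjointPair_walkMat hreg hk).adj]
    by_cases hm : K.mass b = 0
    · simp [hm, pi_eq_zero_of_mass_eq_zero hm hb]
    · field_simp
  · simp

theorem sum_prodDist_mul_Qdown (hpart : IsPartite K) {H : SimpleGraph (Finset (Fin n))}
    {ℓ k : ℕ} (hreg : IsRegularOnSubsets H ℓ k) (hk : 0 < k)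
    (p : Finset (Fin n × U) × Finset (Fin n)) :
    ∑ b, prodDist K ℓ p * Qdown K H k p b = prodDist K ℓ p := by
  simp only [prodDist, mul_assoc]
  rw [← Finset.mul_sum]
  by_cases hω : K.pi p.1 = 0
  · simp [hω]
  · simp only [Qdown_eq]
    rw [← Finset.mul_sum, sum_subset_eq hpart hω]
    simp only [typ_restrict hpart hω]
    rw [Finset.mul_sum, (isAdjointPair_walkMat hreg hk).sum_left]

end Partite

end Expanderized

open Expanderized WComplex in
/-- `Gap(Papx) ≥ Gap(Udw_{ℓ↔n})·Gap*(H)` and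
`Gap(Paqx) ≥ Gap(Duw_{n↔ℓ})·Gap*(H²)` for the expanderized up-down walk
`Papx = UpDown_{ℓ↔n}(X, π, H)` and the expanderized down-up walk
`Paqx = DownUp_{n↔ℓ}(X, π, H)`. -/
theorem statement1 {n ℓ k : ℕ} {U : Type*} [Fintype U] [DecidableEq U]
    (K : WComplex (Fin n × U) n) (hpart : IsPartite K) (hℓ : ℓ ≤ n)
    (H : SimpleGraph (Finset (Fin n))) (hreg : IsRegularOnSubsets H ℓ k) (hk : 0 < k) :
    specGap (K.level ℓ) (K.upDown ℓ) * (1 - lamH H ℓ k) ≤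
        specGap (K.level ℓ) (expUpDown K (walkMat H k)) ∧
      specGap K.pi (K.downUp ℓ) * (1 - lamHsq H ℓ k) ≤
        specGap (prodDist K ℓ) (expDownUp K H k) := by
  have hDU := isAdjointPair_down_up hpart hℓ
  have hW := isAdjointPair_walkMat hreg hk
  have hW2 := hW.matMul_self
  have coef_nonneg : ∀ {t c : ℝ}, 0 ≤ t → t ≤ 1 → 0 ≤ c → 0 ≤ t + (1 - t) * c :=
    fun h0 h1 hc => add_nonneg h0 (mul_nonneg (sub_nonneg.2 h1) hc)
  constructor
  · have h := lambda2_le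
      (coef_nonneg (twoSided_nonneg _ _) hW.twoSided_le_one hDU.symm.lambda2_nonneg)
      fun f hf => inner'_expUpDown_le hpart hℓ hW
        (fun g hg => hDU.symm.matMul_self.inner'_le_lambda2 hg) hf
    simp only [specGap, lamH, WComplex.upDown]
    linarith
  · have hc := coef_nonneg (twoSided_nonneg _ _) hW2.twoSided_le_one hDU.lambda2_nonneg
    have h := lambda2_le hc fun f hf => inner'_matMul_le_of_swap (μ := prodDist K ℓ)
      (fun p => mul_nonneg (pi_nonneg K p.1) (unifSubsets_nonneg n ℓ p.2)) (level_nonneg hpart ℓ)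
      (prodDist_mul_Qdown hpart hreg hk) (sum_prodDist_mul_Qdown hpart hreg hk) hc
      (fun g hg => by
        rw [matMul_Qup_Qdown hpart]
        exact inner'_expUpDown_le hpart hℓ hW2
          (fun u hu => inner'_matMul_le_of_swap hDU.symm.weight_nonneg hDU.weight_nonneg
            hDU.symm.adj hDU.symm.sum_left hDU.lambda2_nonneg
            (fun v hv => hDU.matMul_self.inner'_le_lambda2 hv) hu) hg) hf
    simp only [specGap, lamHsq, WComplex.downUp, expDownUp]
    linarith
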